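/- arXiv:1808.07876 — 6 statements merged into one kernel-verified Lean document; each statement's English description precedes it below -/
import Mathlib

section
/- The unweighted hierarchical product of matrices is associative: for square matrices A, B, C over a commutative ring, (A ⊓ B) ⊓ C = A ⊓ (B ⊓ C), where the two sides are identified via the canonical reindexing (associativity) equivalence of the product index types, and where the root-projector of a hierarchical product B ⊓ C is D_B ⊗ D_C. -/
open Matrix Kronecker

/-- The root projector `D`: the matrix with a `1` in the `(r,r)` entry and `0` elsewhere,
where `r` is the distinguished root index. -/
def rootProj {ι : Type*} [DecidableEq ι] (R : Type*) [CommRing R] (r : ι) : Matrix ι ι R :=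
  fun i j => if i = r ∧ j = r then 1 else 0

/-- The (unweighted) hierarchical product `A ⊓ B = A ⊗ D_B + I ⊗ B`, where `rB` is the
distinguished root index of `B`. -/
def hierProd {R : Type*} [CommRing R] {ι₁ ι₂ : Type*} [DecidableEq ι₁] [DecidableEq ι₂]
    (A : Matrix ι₁ ι₁ R) (B : Matrix ι₂ ι₂ R) (rB : ι₂) : Matrix (ι₁ × ι₂) (ι₁ × ι₂) R :=
  A ⊗ₖ rootProj R rB + (1 : Matrix ι₁ ι₁ R) ⊗ₖ B

theorem rootProj_kronecker_rootProj {R : Type*} [CommRing R] {ι₁ ι₂ : Type*}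
    [DecidableEq ι₁] [DecidableEq ι₂] (r₁ : ι₁) (r₂ : ι₂) :
    rootProj R r₁ ⊗ₖ rootProj R r₂ = rootProj R (r₁, r₂) := by
  ext ⟨i₁, i₂⟩ ⟨j₁, j₂⟩
  simp only [kroneckerMap_apply, rootProj, Prod.mk.injEq, ← ite_and, mul_ite, mul_one, mul_zero]
  congr 1
  grind

/-- the hierarchical product is associative, identifying the two index types via the
canonical associativity equivalence; the root of `B ⊓ C` is `(rB, rC)` (so its root projector is
`D_B ⊗ D_C`). -/
theorem hierProd_assoc {R : Type*} [CommRing R] {ι₁ ι₂ ι₃ : Type*}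
    [DecidableEq ι₁] [DecidableEq ι₂] [DecidableEq ι₃]
    (A : Matrix ι₁ ι₁ R) (B : Matrix ι₂ ι₂ R) (C : Matrix ι₃ ι₃ R) (rB : ι₂) (rC : ι₃) :
    hierProd (hierProd A B rB) C rC
      = (hierProd A (hierProd B C rC) (rB, rC)).submatrix
          (Equiv.prodAssoc ι₁ ι₂ ι₃) (Equiv.prodAssoc ι₁ ι₂ ι₃) := by
  unfold hierProd
  rw [← rootProj_kronecker_rootProj, kronecker_add, add_kronecker, ← one_kronecker_one, add_assoc]
  simp only [submatrix_add, Pi.add_apply, ← kronecker_assoc', submatrix_submatrix]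
  simp
end

section
/- The three-fold weighted hierarchical product evaluated from right to left expands as a weighted sum of Kronecker products: for square matrices A_1, A_2, A_3 over a commutative ring and scalars α_1, α_2, α_3, one has A_3 ⊓_{α_3} (A_2 ⊓_{α_2} (α_1 · A_1)) = α_3 · A_3 ⊗ D_2 ⊗ D_1 + α_2 · I_3 ⊗ A_2 ⊗ D_1 + α_1 · I_3 ⊗ I_2 ⊗ A_1, where the root-projector associated with the product A_2 ⊓_{α_2} (α_1 A_1) is D_2 ⊗ D_1, and the two sides are identified via the canonical reindexing of iterated product index types. -/
open Matrix Kronecker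

/-- The `α`-weighted hierarchical product `A ⊓_α B = α•A ⊗ D_B + I ⊗ B`, where `rB` is the
distinguished root index of `B`. -/
def hierProdW {R : Type*} [CommRing R] {ι₁ ι₂ : Type*} [DecidableEq ι₁] [DecidableEq ι₂]
    (α : R) (A : Matrix ι₁ ι₁ R) (B : Matrix ι₂ ι₂ R) (rB : ι₂) :
    Matrix (ι₁ × ι₂) (ι₁ × ι₂) R :=
  (α • A) ⊗ₖ rootProj R rB + (1 : Matrix ι₁ ι₁ R) ⊗ₖ B

theorem rootProj_prod {ι₁ ι₂ : Type*} [DecidableEq ι₁] [DecidableEq ι₂]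
    (R : Type*) [CommRing R] (r : ι₁ × ι₂) :
    rootProj R r = rootProj R r.1 ⊗ₖ rootProj R r.2 := by
  ext i j
  simp only [rootProj, kroneckerMap_apply, Prod.ext_iff, ite_zero_mul_ite_zero, mul_one]
  grind

/-- the three-fold weighted hierarchical product, evaluated from right to left,
expands as `A₃ ⊓_{α₃} (A₂ ⊓_{α₂} (α₁•A₁)) = α₃•A₃⊗D₂⊗D₁ + α₂•I₃⊗A₂⊗D₁ + α₁•I₃⊗I₂⊗A₁`,
where the root projector of `A₂ ⊓_{α₂} (α₁•A₁)` is the one at root `(r₂, r₁)`,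
i.e. `D₂ ⊗ D₁`. -/
theorem hierProdW_threefold {R : Type*} [CommRing R] {ι₁ ι₂ ι₃ : Type*}
    [DecidableEq ι₁] [DecidableEq ι₂] [DecidableEq ι₃]
    (A₁ : Matrix ι₁ ι₁ R) (A₂ : Matrix ι₂ ι₂ R) (A₃ : Matrix ι₃ ι₃ R)
    (α₁ α₂ α₃ : R) (r₁ : ι₁) (r₂ : ι₂) :
    hierProdW α₃ A₃ (hierProdW α₂ A₂ (α₁ • A₁) r₁) (r₂, r₁)
      = α₃ • (A₃ ⊗ₖ (rootProj R r₂ ⊗ₖ rootProj R r₁))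
        + α₂ • ((1 : Matrix ι₃ ι₃ R) ⊗ₖ (A₂ ⊗ₖ rootProj R r₁))
        + α₁ • ((1 : Matrix ι₃ ι₃ R) ⊗ₖ ((1 : Matrix ι₂ ι₂ R) ⊗ₖ A₁)) := by
  simp only [hierProdW, rootProj_prod, kronecker_add, smul_kronecker, kronecker_smul, add_assoc]
end

section
/- Let K be a real symmetric n × n matrix with eigenvalues κ_1, …, κ_n listed with multiplicity, let L be any real m × m matrix, and let α be a real number. Then the characteristic polynomial of the weighted hierarchical product factors into blocks: charpoly(α·K ⊗ D_m + I_n ⊗ L) = ∏_{j=1}^{n} charpoly(α·κ_j·D_m + L), where D_m is the m × m matrix with a 1 in the (0,0) entry and 0 elsewhere. -/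
open Matrix Kronecker Polynomial

namespace Matrix

variable {R m n : Type*} [CommRing R] [Fintype m] [DecidableEq m] [Fintype n] [DecidableEq n]

theorem charpoly_blockDiagonal (M : n → Matrix m m R) :
    (blockDiagonal M).charpoly = ∏ j, (M j).charpoly := by
  have h : (blockDiagonal M).charmatrix = blockDiagonal fun j => (M j).charmatrix := by
    ext ⟨a, i⟩ ⟨b, j⟩
    by_cases hij : i = j <;> by_cases hab : a = b <;>
      simp [blockDiagonal_apply, hij, hab]
  simp only [charpoly, h, det_blockDiagonal]

theorem charpoly_diagonal_kronecker_add_one_kronecker (d : n → R) (B L : Matrix m m R) :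
    (diagonal d ⊗ₖ B + (1 : Matrix n n R) ⊗ₖ L).charpoly = ∏ j, (d j • B + L).charpoly := by
  rw [diagonal_kronecker, one_kronecker, ← charpoly_blockDiagonal,
    ← charpoly_reindex (Equiv.prodComm m n) (blockDiagonal _)]
  congr 1
  ext ⟨i, a⟩ ⟨j, b⟩
  by_cases hij : i = j <;> simp [blockDiagonal_apply, hij]

/-- Conjugating `A` by an invertible matrix does not change the characteristic polynomial of
`A ⊗ₖ B + 1 ⊗ₖ L`. -/
theorem charpoly_conj_kronecker_add_one_kronecker {P Q : Matrix n n R} (h : Q * P = 1)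
    (A : Matrix n n R) (B L : Matrix m m R) :
    ((P * A * Q) ⊗ₖ B + (1 : Matrix n n R) ⊗ₖ L).charpoly =
      (A ⊗ₖ B + (1 : Matrix n n R) ⊗ₖ L).charpoly := by
  have h' : P * Q = 1 := mul_eq_one_comm.mp h
  have hconj : (P * A * Q) ⊗ₖ B + (1 : Matrix n n R) ⊗ₖ L =
      P ⊗ₖ (1 : Matrix m m R) * (A ⊗ₖ B + (1 : Matrix n n R) ⊗ₖ L) *
        Q ⊗ₖ (1 : Matrix m m R) := by
    simp only [mul_add, add_mul, ← mul_kronecker_mul, one_mul, mul_one, h']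
  rw [hconj, charpoly_mul_comm, ← mul_assoc, ← mul_kronecker_mul, h, one_mul, one_kronecker_one,
    one_mul]

theorem IsHermitian.charpoly_kronecker_add_one_kronecker {K : Matrix n n ℝ} (hK : K.IsHermitian)
    (B L : Matrix m m ℝ) :
    (K ⊗ₖ B + (1 : Matrix n n ℝ) ⊗ₖ L).charpoly =
      ∏ j, (hK.eigenvalues j • B + L).charpoly := by
  conv_lhs => rw [hK.spectral_theorem, Unitary.conjStarAlgAut_apply]
  rw [charpoly_conj_kronecker_add_one_kronecker (Unitary.coe_star_mul_self _),
    charpoly_diagonal_kronecker_add_one_kronecker]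
  rfl

end Matrix

/-- if `K` is a real symmetric `n × n` matrix whose eigenvalues (with multiplicity)
are `κ₁, …, κₙ` — i.e. its characteristic polynomial is `∏ⱼ (X - κⱼ)` — and `L` is any real
`m × m` matrix, then the characteristic polynomial of the weighted hierarchical product
`α•K ⊗ D_m + I_n ⊗ L` factors as `∏ⱼ charpoly (α·κⱼ·D_m + L)`, where `D_m` has a `1` in the
`(0,0)` entry and `0` elsewhere. -/
theorem charpoly_hierProdW_blocks {n m : ℕ} [NeZero m]
    (K : Matrix (Fin n) (Fin n) ℝ) (L : Matrix (Fin m) (Fin m) ℝ)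
    (α : ℝ) (κ : Fin n → ℝ)
    (hK : K.IsSymm)
    (hκ : K.charpoly = ∏ j : Fin n, (X - C (κ j))) :
    ((α • K) ⊗ₖ rootProj ℝ (0 : Fin m) + (1 : Matrix (Fin n) (Fin n) ℝ) ⊗ₖ L).charpoly
      = ∏ j : Fin n, ((α * κ j) • rootProj ℝ (0 : Fin m) + L).charpoly := by
  have hH : K.IsHermitian := by rwa [IsHermitian, conjTranspose_eq_transpose_of_trivial]
  have hroots : Finset.univ.val.map hH.eigenvalues = Finset.univ.val.map κ := by
    have h := congrArg Polynomial.roots (hH.charpoly_eq.symm.trans hκ)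
    simpa [Polynomial.roots_prod, Finset.prod_ne_zero_iff, X_sub_C_ne_zero] using h
  rw [smul_kronecker, ← kronecker_smul, hH.charpoly_kronecker_add_one_kronecker]
  have hprod := congrArg
    (fun s => (s.map fun x => (x • α • rootProj ℝ (0 : Fin m) + L).charpoly).prod) hroots
  simpa only [Multiset.map_map, Function.comp_def, smul_smul, mul_comm α,
    Finset.prod_eq_multiset_prod] using hprod
end

section
/- (Lemma 1.) Let K be a real symmetric n_K × n_K matrix and L a real symmetric m × m matrix (m ≥ 2), let α be a nonzero real number, and denote by φ_K, φ_L the characteristic polynomials of K and L and by φ_{L'} the characteristic polynomial of the (m−1) × (m−1) matrix L' obtained from L by deleting its first row and first column. Then for every real x with φ_{L'}(x) ≠ 0, the characteristic polynomial φ_⊓ of the weighted hierarchical product K ⊓_α L satisfies φ_⊓(x) = (α·φ_{L'}(x))^{n_K} · φ_K( φ_L(x) / (α·φ_{L'}(x)) ). -/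
open Matrix Kronecker Polynomial

/-- Splits off the first index of the second factor. -/
def sumProdEquivProdFinSucc (ι : Type*) (m : ℕ) : ι ⊕ ι × Fin m ≃ ι × Fin (m + 1) where
  toFun := Sum.elim (fun i => (i, 0)) (fun p => (p.1, p.2.succ))
  invFun p := Fin.cases (Sum.inl p.1) (fun j => Sum.inr (p.1, j)) p.2
  left_inv := by rintro (i | ⟨i, j⟩) <;> simp
  right_inv := by
    rintro ⟨i, j⟩
    induction j using Fin.cases <;> simp

/-- Determinant of `I ⊗ N - A ⊗ D` in terms of the Schur complement of the lower-right block
of `N`. -/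
lemma det_one_kronecker_sub_kronecker_rootProj {R ι : Type*} [CommRing R] [Fintype ι]
    [DecidableEq ι] {m : ℕ} (A : Matrix ι ι R) (N : Matrix (Fin (m + 1)) (Fin (m + 1)) R)
    (hN : IsUnit (N.submatrix Fin.succ Fin.succ).det) :
    ((1 : Matrix ι ι R) ⊗ₖ N - A ⊗ₖ rootProj R 0).det =
      (N.submatrix Fin.succ Fin.succ).det ^ Fintype.card ι *
        (scalar ι (N 0 0 - (fun j : Fin m => N 0 j.succ) ⬝ᵥ
          ((N.submatrix Fin.succ Fin.succ)⁻¹ *ᵥ fun j => N j.succ 0)) - A).det := by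
  set P := N.submatrix Fin.succ Fin.succ with hP
  let b : Matrix ι (ι × Fin m) R :=
    Matrix.of fun i p => if i = p.1 then N 0 p.2.succ else 0
  let c : Matrix (ι × Fin m) ι R :=
    Matrix.of fun p i => if p.1 = i then N p.2.succ 0 else 0
  have hblock : ((1 : Matrix ι ι R) ⊗ₖ N - A ⊗ₖ rootProj R 0).submatrix
      (sumProdEquivProdFinSucc ι m) (sumProdEquivProdFinSucc ι m) =
        fromBlocks (scalar ι (N 0 0) - A) b c ((1 : Matrix ι ι R) ⊗ₖ P) := by
    ext (i | ⟨i, j⟩) (k | ⟨k, l⟩) <;>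
      simp [sumProdEquivProdFinSucc, rootProj, kroneckerMap_apply, one_apply, diagonal_apply,
        b, c, hP]
  have hdet : ((1 : Matrix ι ι R) ⊗ₖ P).det = P.det ^ Fintype.card ι := by
    simp [det_kronecker]
  have := invertibleOfIsUnitDet ((1 : Matrix ι ι R) ⊗ₖ P) (hdet ▸ hN.pow _)
  have hschur : b * ((1 : Matrix ι ι R) ⊗ₖ P⁻¹) * c =
      scalar ι ((fun j : Fin m => N 0 j.succ) ⬝ᵥ (P⁻¹ *ᵥ fun j => N j.succ 0)) := by
    rw [Matrix.mul_assoc]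
    ext i k
    rw [scalar_apply, diagonal_apply]
    simp [b, c, mul_apply, kroneckerMap_apply, one_apply, Fintype.sum_prod_type,
      dotProduct, mulVec, ite_mul, mul_ite, Finset.sum_ite_irrel]
  rw [← det_submatrix_equiv_self (sumProdEquivProdFinSucc ι m), hblock, det_fromBlocks₂₂, hdet,
    invOf_eq_nonsing_inv, inv_kronecker, inv_one, hschur, map_sub, sub_right_comm]

/-- The Schur complement of the lower-right block computes the determinant. -/
lemma det_eq_det_submatrix_succ_mul {R : Type*} [CommRing R] {m : ℕ}
    (N : Matrix (Fin (m + 1)) (Fin (m + 1)) R)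
    (hN : IsUnit (N.submatrix Fin.succ Fin.succ).det) :
    N.det = (N.submatrix Fin.succ Fin.succ).det *
      (N 0 0 - (fun j : Fin m => N 0 j.succ) ⬝ᵥ
        ((N.submatrix Fin.succ Fin.succ)⁻¹ *ᵥ fun j => N j.succ 0)) := by
  simpa [det_kronecker] using
    det_one_kronecker_sub_kronecker_rootProj (0 : Matrix Unit Unit R) N hN

/-- Lemma 1: for `K` real symmetric of size `n_K`, `L` real symmetric of size
`m + 1 ≥ 2`, and `α ≠ 0`, letting `L'` be `L` with its first row and column deleted, for every
real `x` with `φ_{L'}(x) ≠ 0` one has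
`φ_⊓(x) = (α·φ_{L'}(x))^{n_K} · φ_K(φ_L(x) / (α·φ_{L'}(x)))`,
where `φ_⊓` is the characteristic polynomial of `K ⊓_α L`. -/
theorem charpoly_hierProdW_eval {nK m : ℕ} (hm : 1 ≤ m)
    (K : Matrix (Fin nK) (Fin nK) ℝ) (L : Matrix (Fin (m + 1)) (Fin (m + 1)) ℝ)
    (α : ℝ) (hα : α ≠ 0) (hK : K.IsSymm) (hL : L.IsSymm)
    (x : ℝ)
    (hx : ((L.submatrix Fin.succ Fin.succ).charpoly).eval x ≠ 0) :
    ((hierProdW α K L (0 : Fin (m + 1))).charpoly).eval x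
      = (α * ((L.submatrix Fin.succ Fin.succ).charpoly).eval x) ^ nK
        * (K.charpoly).eval
            ((L.charpoly).eval x / (α * ((L.submatrix Fin.succ Fin.succ).charpoly).eval x)) := by
  have hsub : scalar (Fin m) x - L.submatrix Fin.succ Fin.succ =
      (scalar (Fin (m + 1)) x - L).submatrix Fin.succ Fin.succ := by
    ext i j
    simp [diagonal_apply]
  have hprod : scalar (Fin nK × Fin (m + 1)) x - hierProdW α K L 0 =
      (1 : Matrix (Fin nK) (Fin nK) ℝ) ⊗ₖ (scalar (Fin (m + 1)) x - L) -
        (α • K) ⊗ₖ rootProj ℝ 0 := by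
    have hscalar : scalar (Fin nK × Fin (m + 1)) x =
        (1 : Matrix (Fin nK) (Fin nK) ℝ) ⊗ₖ scalar (Fin (m + 1)) x := by
      ext ⟨i, j⟩ ⟨k, l⟩
      simp [kroneckerMap_apply, one_apply, diagonal_apply, ← ite_and, and_comm]
    rw [hscalar, hierProdW, sub_eq_add_neg _ L, kronecker_add, ← neg_one_smul ℝ L,
      kronecker_smul, neg_one_smul]
    abel
  simp only [eval_charpoly, hsub] at hx ⊢
  rw [hprod, det_one_kronecker_sub_kronecker_rootProj _ _ hx.isUnit,
    det_eq_det_submatrix_succ_mul _ hx.isUnit, mul_comm α, mul_div_mul_left _ _ hx, mul_pow,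
    mul_assoc, Fintype.card_fin]
  congr 1
  generalize (scalar (Fin (m + 1)) x - L) 0 0 - _ = s
  have hfactor : scalar (Fin nK) s - α • K = α • (scalar (Fin nK) (s / α) - K) := by
    ext i j
    simp [diagonal_apply, mul_sub, mul_div_cancel₀ _ hα]
  rw [hfactor, det_smul, Fintype.card_fin]
end

section
/- (Lemma 2.) Let K be a real symmetric n_K × n_K matrix, L a real m × m matrix (m ≥ 2), and α a real number. If a real number x is an eigenvalue of the weighted hierarchical product K ⊓_α L (i.e., a root of its characteristic polynomial), then there exists an eigenvalue κ of K such that φ_L(x) = α·κ·φ_{L'}(x), where φ_L is the characteristic polynomial of L and φ_{L'} is the characteristic polynomial of the matrix L' obtained from L by deleting its first row and first column. -/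
open Matrix Kronecker Polynomial

/-- Subtracting `c` from the root diagonal entry changes the determinant by `c` times the
principal minor obtained by deleting the root. -/
theorem det_sub_smul_rootProj_zero {R : Type*} [CommRing R] {m : ℕ}
    (M : Matrix (Fin (m + 1)) (Fin (m + 1)) R) (c : R) :
    (M - c • rootProj R 0).det = M.det - c * (M.submatrix Fin.succ Fin.succ).det := by
  have h : M - c • rootProj R 0 = M.updateRow 0 (M 0 + (-c) • Pi.single 0 1) := by
    ext i j
    by_cases hi : i = 0 <;> by_cases hj : j = 0 <;>
      simp [rootProj, hi, hj, sub_eq_add_neg, updateRow_apply]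
  have h' := adjugate_fin_succ_eq_det_submatrix M 0 0
  rw [adjugate_apply] at h'
  rw [h, det_updateRow_add, updateRow_eq_self, det_updateRow_smul, h']
  simp [sub_eq_add_neg, Fin.succAbove_zero]

/-- Kronecker conjugation by `P` with inverse `Q` acts on the first factor of the
hierarchical product. -/
theorem charpoly_hierProdW_conj {R : Type*} [CommRing R] {ι₁ ι₂ : Type*} [Fintype ι₁]
    [Fintype ι₂] [DecidableEq ι₁] [DecidableEq ι₂] (α : R) (P A Q : Matrix ι₁ ι₁ R)
    (hQP : Q * P = 1) (B : Matrix ι₂ ι₂ R) (r : ι₂) :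
    (hierProdW α (P * A * Q) B r).charpoly = (hierProdW α A B r).charpoly := by
  have hPQ : P * Q = 1 := mul_eq_one_comm.mp hQP
  have h : hierProdW α (P * A * Q) B r =
      P ⊗ₖ (1 : Matrix ι₂ ι₂ R) * (hierProdW α A B r * Q ⊗ₖ (1 : Matrix ι₂ ι₂ R)) := by
    simp only [hierProdW, add_mul, mul_add, ← mul_kronecker_mul, one_mul, mul_one, hPQ,
      smul_mul_assoc, mul_smul_comm, mul_assoc]
  rw [h, charpoly_mul_comm, mul_assoc, ← mul_kronecker_mul, hQP, one_mul, one_kronecker_one,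
    mul_one]

/-- The hierarchical product with a diagonal first factor is block diagonal. -/
theorem det_scalar_sub_hierProdW_diagonal {R : Type*} [CommRing R] {ι₁ ι₂ : Type*} [Fintype ι₁]
    [Fintype ι₂] [DecidableEq ι₁] [DecidableEq ι₂] (α x : R) (d : ι₁ → R)
    (B : Matrix ι₂ ι₂ R) (r : ι₂) :
    (scalar (ι₁ × ι₂) x - hierProdW α (diagonal d) B r).det =
      ∏ i, (scalar ι₂ x - B - (α * d i) • rootProj R r).det := by
  rw [← det_blockDiagonal, ← det_reindex_self (Equiv.prodComm ι₁ ι₂)]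
  congr 1
  ext ⟨i, k⟩ ⟨j, l⟩
  by_cases hkl : k = l <;> by_cases hij : i = j <;>
    simp [hierProdW, blockDiagonal_apply, hkl, hij, kroneckerMap_apply,
      one_apply, Prod.ext_iff] <;> ring

/-- Lemma 2: for `K` real symmetric of size `n_K`, `L` a real matrix of size
`m + 1 ≥ 2`, and `α` real, if `x` is an eigenvalue of `K ⊓_α L` (a root of its characteristic
polynomial), then there is an eigenvalue `κ` of `K` (a root of `φ_K`) such that
`φ_L(x) = α·κ·φ_{L'}(x)`, where `L'` is `L` with its first row and column deleted. -/
theorem eigenvalue_hierProdW_recursive {nK m : ℕ} (hm : 1 ≤ m)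
    (K : Matrix (Fin nK) (Fin nK) ℝ) (L : Matrix (Fin (m + 1)) (Fin (m + 1)) ℝ)
    (α : ℝ) (hK : K.IsSymm)
    (x : ℝ)
    (hx : ((hierProdW α K L (0 : Fin (m + 1))).charpoly).eval x = 0) :
    ∃ κ : ℝ, (K.charpoly).eval κ = 0 ∧
      (L.charpoly).eval x = α * κ * ((L.submatrix Fin.succ Fin.succ).charpoly).eval x := by
  have hH : K.IsHermitian := by
    rw [IsHermitian, conjTranspose_eq_transpose_of_trivial]
    exact hK
  have hspec := hH.spectral_theorem
  rw [Unitary.conjStarAlgAut_apply] at hspec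
  have hcp := charpoly_hierProdW_conj α (hH.eigenvectorUnitary : Matrix (Fin nK) (Fin nK) ℝ)
    (diagonal (RCLike.ofReal ∘ hH.eigenvalues))
    (star (hH.eigenvectorUnitary : Matrix (Fin nK) (Fin nK) ℝ))
    (Unitary.coe_star_mul_self hH.eigenvectorUnitary) L 0
  rw [← hspec] at hcp
  rw [hcp, eval_charpoly, det_scalar_sub_hierProdW_diagonal, Finset.prod_eq_zero_iff] at hx
  obtain ⟨i, -, hi⟩ := hx
  refine ⟨hH.eigenvalues i, ?_, ?_⟩
  · rw [hH.charpoly_eq, eval_prod]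
    exact Finset.prod_eq_zero (Finset.mem_univ i) (by simp)
  · rw [det_sub_smul_rootProj_zero, sub_eq_zero] at hi
    rw [eval_charpoly, eval_charpoly, hi]
    congr 2
    ext a b
    simp [diagonal_apply]
end

section
/- Closed form for the total edge weight of a geometrically weighted complete-graph hierarchy: let n ≥ 2 be an integer, α a real number with α ≠ n, and let A be the adjacency matrix of the complete graph K_n. Define recursively A^{(1)} = A and A^{(i+1)} = A ⊓_{α^i} A^{(i)}. Then for every k ≥ 1, the sum of all entries of A^{(k)} equals n(n−1)·(n^k − α^k)/(n − α); equivalently, the total edge weight of K_n^{⊓_α k} is (n(n−1)/2)·(n^k − α^k)/(n − α). -/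
open Matrix Kronecker

/-- Index type of the `k`-level hierarchy with base of order `n` (levels counted from `1`). -/
def hierIdx (n : ℕ) : ℕ → Type
  | 0 => PUnit
  | 1 => Fin n
  | (k + 2) => Fin n × hierIdx n (k + 1)

def hierIdxDecEq (n : ℕ) : (k : ℕ) → DecidableEq (hierIdx n k)
  | 0 => inferInstanceAs (DecidableEq PUnit)
  | 1 => inferInstanceAs (DecidableEq (Fin n))
  | (k + 2) => letI := hierIdxDecEq n (k + 1); inferInstanceAs (DecidableEq (Fin n × hierIdx n (k + 1)))

instance (n k : ℕ) : DecidableEq (hierIdx n k) := hierIdxDecEq n k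

def hierIdxFintype (n : ℕ) : (k : ℕ) → Fintype (hierIdx n k)
  | 0 => inferInstanceAs (Fintype PUnit)
  | 1 => inferInstanceAs (Fintype (Fin n))
  | (k + 2) => letI := hierIdxFintype n (k + 1); inferInstanceAs (Fintype (Fin n × hierIdx n (k + 1)))

instance (n k : ℕ) : Fintype (hierIdx n k) := hierIdxFintype n k

/-- The root of the `k`-level hierarchy. -/
def hierRoot (n : ℕ) [NeZero n] : (k : ℕ) → hierIdx n k
  | 0 => PUnit.unit
  | 1 => (0 : Fin n)
  | (k + 2) => ((0 : Fin n), hierRoot n (k + 1))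

/-- The adjacency matrix of the complete graph `K_n`: `0` on the diagonal, `1` off it. -/
def completeAdj (n : ℕ) : Matrix (Fin n) (Fin n) ℝ :=
  fun i j => if i = j then 0 else 1

/-- The adjacency matrix of the geometrically weighted complete-graph hierarchy:
`A^{(1)} = A(K_n)` and `A^{(i+1)} = A(K_n) ⊓_{α^i} A^{(i)}`. -/
def hierKnA (n : ℕ) [NeZero n] (α : ℝ) : (k : ℕ) → Matrix (hierIdx n k) (hierIdx n k) ℝ
  | 0 => 0
  | 1 => completeAdj n
  | (k + 2) => hierProdW (α ^ (k + 1)) (completeAdj n) (hierKnA n α (k + 1)) (hierRoot n (k + 1))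

theorem sum_entries_kronecker {R ι₁ ι₂ : Type*} [CommRing R] [Fintype ι₁] [Fintype ι₂]
    (A : Matrix ι₁ ι₁ R) (B : Matrix ι₂ ι₂ R) :
    ∑ p, ∑ q, (A ⊗ₖ B) p q = (∑ i, ∑ j, A i j) * ∑ i, ∑ j, B i j := by
  simp only [Fintype.sum_prod_type, kroneckerMap_apply, ← Finset.mul_sum, ← Finset.sum_mul]

theorem sum_entries_rootProj {R ι : Type*} [CommRing R] [Fintype ι] [DecidableEq ι] (r : ι) :
    ∑ i, ∑ j, rootProj R r i j = 1 := by
  simp [rootProj, ite_and]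

/-- Entry sums under the weighted hierarchical product: each of the `|ι₁|` copies of `B` contributes
its own sum, and the root projector carries the sum of `α • A` once. -/
theorem sum_entries_hierProdW {R ι₁ ι₂ : Type*} [CommRing R] [Fintype ι₁] [Fintype ι₂]
    [DecidableEq ι₁] [DecidableEq ι₂] (α : R) (A : Matrix ι₁ ι₁ R) (B : Matrix ι₂ ι₂ R)
    (r : ι₂) :
    ∑ p, ∑ q, hierProdW α A B r p q
      = α * ∑ i, ∑ j, A i j + Fintype.card ι₁ * ∑ i, ∑ j, B i j := by
  simp only [hierProdW, Matrix.add_apply, Finset.sum_add_distrib, sum_entries_kronecker,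
    sum_entries_rootProj]
  simp [Finset.mul_sum, one_apply]

theorem sum_entries_completeAdj (n : ℕ) :
    ∑ i, ∑ j, completeAdj n i j = (n : ℝ) * ((n : ℝ) - 1) := by
  have h (i j : Fin n) : completeAdj n i j = 1 - if i = j then 1 else 0 := by
    unfold completeAdj; split_ifs <;> simp
  simp [h, mul_sub_one]

theorem sum_entries_hierKnA_add_two (n k : ℕ) [NeZero n] (α : ℝ) :
    ∑ p, ∑ q, hierKnA n α (k + 2) p q
      = α ^ (k + 1) * ((n : ℝ) * ((n : ℝ) - 1)) + n * ∑ p, ∑ q, hierKnA n α (k + 1) p q := by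
  have h := sum_entries_hierProdW (α ^ (k + 1)) (completeAdj n) (hierKnA n α (k + 1))
    (hierRoot n (k + 1))
  rw [sum_entries_completeAdj, Fintype.card_fin] at h
  exact h

/-- for `n ≥ 2` and `α ≠ n`, the sum of all entries of `A^{(k)}` (for `k ≥ 1`)
equals `n(n−1)·(n^k − α^k)/(n − α)`; i.e. the total edge weight of `K_n^{⊓_α k}` is
`(n(n−1)/2)·(n^k − α^k)/(n − α)`. -/
theorem sum_entries_hierKnA (n k : ℕ) [NeZero n] (α : ℝ)
    (hn : 2 ≤ n) (hα : α ≠ (n : ℝ)) (hk : 1 ≤ k) :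
    ∑ p : hierIdx n k, ∑ q : hierIdx n k, hierKnA n α k p q
      = (n : ℝ) * ((n : ℝ) - 1) * ((n : ℝ) ^ k - α ^ k) / ((n : ℝ) - α) := by
  have hne : (n : ℝ) - α ≠ 0 := sub_ne_zero.mpr hα.symm
  induction k, hk using Nat.le_induction with
  | base =>
    rw [pow_one, pow_one, mul_div_cancel_right₀ _ hne]
    exact sum_entries_completeAdj n
  | succ m hm ih =>
    obtain ⟨k, rfl⟩ := Nat.exists_eq_add_of_le' hm
    rw [sum_entries_hierKnA_add_two, ih]
    field_simp
    ring
end
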